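/- arXiv:0903.4617 — 2 statements merged into one kernel-verified Lean document; each statement's English description precedes it below -/
import Mathlib

section
/- Let ⟨X, φ, (P, 𝕋, θ)⟩ be a nonautonomous dynamical system. The chain recurrent set is forward invariant: if x : P → X is a chain recurrent map and s ∈ 𝕋⁺, then the map p ↦ φ(s, θ_{-s} p, x(θ_{-s} p)) is chain recurrent; in particular φ(s, p, x(p)) ∈ CR_φ(θ_s p) for every p ∈ P, i.e., φ(s, p, CR_φ(p)) ⊂ CR_φ(θ_s p). -/
open Set Metric Filter Topology TopologicalSpace

/-- A nonautonomous dynamical system ⟨X, φ, (P, ℝ, θ)⟩: a continuous driving group `θ`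
on the base space `P` and a continuous cocycle `φ` on the state space `X`
(the cocycle property is required for nonnegative times only). -/
structure NDS (P X : Type*) [MetricSpace P] [MetricSpace X] where
  θ : ℝ → P → P
  φ : ℝ → P → X → X
  theta_cont : Continuous fun q : ℝ × P => θ q.1 q.2
  theta_zero : ∀ p, θ 0 p = p
  theta_add : ∀ t s p, θ (t + s) p = θ t (θ s p)
  phi_cont : Continuous fun q : ℝ × P × X => φ q.1 q.2.1 q.2.2
  phi_zero : ∀ p x, φ 0 p x = x
  cocycle : ∀ t s p x, 0 ≤ t → 0 ≤ s → φ (t + s) p x = φ t (θ s p) (φ s p x)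

namespace NDS

variable {P X : Type*} [MetricSpace P] [MetricSpace X]

/-- The set `cl (⋃_{t ≥ T} φ(t, θ_{-t} p, U(θ_{-t} p)))` entering the definitions of
pre-attractors and local attractors. -/
def omegaSet (S : NDS P X) (U : P → Set X) (T : ℝ) (p : P) : Set X :=
  closure (⋃ t ∈ Set.Ici T, S.φ t (S.θ (-t) p) '' U (S.θ (-t) p))

/-- An open nonautonomous set `U` is a pre-attractor (with function `τ`) if
`cl (⋃_{t ≥ τ(p)} φ(t, θ_{-t} p, U(θ_{-t} p))) ⊆ U(p)` for every `p`. -/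
def IsPreAttractor (S : NDS P X) (U : P → Set X) (τ : P → ℝ) : Prop :=
  (∀ p, IsOpen (U p)) ∧ (∀ p, 0 < τ p) ∧ ∀ p, S.omegaSet U (τ p) p ⊆ U p

/-- The local attractor determined by a pre-attractor `U` (with function `τ`):
`A(p) = ⋂_{n ∈ ℕ} cl (⋃_{s ≥ n τ(p)} φ(s, θ_{-s} p, U(θ_{-s} p)))`. -/
def localAttractor (S : NDS P X) (U : P → Set X) (τ : P → ℝ) (p : P) : Set X :=
  ⋂ n : ℕ, S.omegaSet U ((n : ℝ) * τ p) p

/-- The basin of attraction determined by `U` (and its local attractor):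
`B(A,U)(p) = {x : φ(t, p, x) ∈ U(θ_t p) for some t ≥ 0}`. -/
def basin (S : NDS P X) (U : P → Set X) (p : P) : Set X :=
  {x | ∃ t, 0 ≤ t ∧ S.φ t p x ∈ U (S.θ t p)}

/-- Membership in the class `F(P × X)`: functions `ε : P × X → (0, ∞)` continuous
in the second variable for each fixed `p`. -/
def IsGauge {P X : Type*} [MetricSpace P] [MetricSpace X] (ε : P → X → ℝ) : Prop :=
  (∀ p : P, Continuous (ε p)) ∧ ∀ (p : P) (x : X), 0 < ε p x

/-- An `(ε, T)(p)`-chain for the NDS `S` from `x(p)` to `y(p)`: a finite sequence of maps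
`x_1, …, x_{n+1} : P → X` and times `t_1, …, t_n ≥ T(p)` with `x_1(p) = x(p)`,
`x_{n+1}(p) = y(p)` and
`d(φ(t_i, θ_{-t_i} p, x_i(θ_{-t_i} p)), x_{i+1}(p)) < ε(p, φ(t_i, θ_{-t_i} p, x_i(θ_{-t_i} p)))`. -/
def IsChainFT (S : NDS P X) (ε : P → X → ℝ) (T : P → ℝ) (p : P) (x y : P → X) : Prop :=
  ∃ n : ℕ, ∃ xs : Fin (n + 2) → P → X, ∃ ts : Fin (n + 1) → ℝ,
    xs 0 p = x p ∧ xs (Fin.last (n + 1)) p = y p ∧ (∀ i, T p ≤ ts i) ∧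
    ∀ i : Fin (n + 1),
      dist (S.φ (ts i) (S.θ (-ts i) p) (xs i.castSucc (S.θ (-ts i) p))) (xs i.succ p)
        < ε p (S.φ (ts i) (S.θ (-ts i) p) (xs i.castSucc (S.θ (-ts i) p)))

/-- A map `x : P → X` is chain recurrent if for every admissible `ε` and every positive `T`
there is an `(ε, T)(p)`-chain from `x(p)` back to `x(p)`, for every `p`. -/
def ChainRecurrentMap (S : NDS P X) (x : P → X) : Prop :=
  ∀ ε : P → X → ℝ, IsGauge ε → ∀ T : P → ℝ, (∀ p, 0 < T p) → ∀ p, S.IsChainFT ε T p x x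

/-- The chain recurrent set `CR_φ(p) = {x(p) : x : P → X chain recurrent}`. -/
def CR (S : NDS P X) (p : P) : Set X :=
  {y | ∃ x : P → X, S.ChainRecurrentMap x ∧ x p = y}

/-- Two chain recurrent maps belong to the same chain transitive component if there are
`(ε, T)(p)`-chains between them in both directions, for all admissible `ε`, `T` and `p`. -/
def ChainEquivMaps (S : NDS P X) (x y : P → X) : Prop :=
  S.ChainRecurrentMap x ∧ S.ChainRecurrentMap y ∧
  ∀ ε : P → X → ℝ, IsGauge ε → ∀ T : P → ℝ, (∀ p, 0 < T p) →
    ∀ p, S.IsChainFT ε T p x y ∧ S.IsChainFT ε T p y x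

/-- A complete Lyapunov function for the NDS `S`. -/
def IsCompleteLyapunov (S : NDS P X) (L : P → X → ℝ) : Prop :=
  (∀ p x, 0 ≤ L p x) ∧ (∀ p, Continuous (L p)) ∧
  (∀ p, ∀ x ∈ S.CR p, ∀ t > 0, L (S.θ t p) (S.φ t p x) = L p x) ∧
  (∀ p, ∀ x ∉ S.CR p, ∀ t > 0, L (S.θ t p) (S.φ t p x) ≤ L p x) ∧
  (∀ p, IsCompact (L p '' S.CR p) ∧ L p '' S.CR p ⊆ Set.Icc 0 1 ∧
    IsNowhereDense (L p '' S.CR p)) ∧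
  (∀ x y : P → X, S.ChainRecurrentMap x → S.ChainRecurrentMap y → ∀ p,
    (S.ChainEquivMaps x y → L p (x p) = L p (y p)) ∧
    (¬ S.ChainEquivMaps x y → L p (x p) ≠ L p (y p)))

/-- The Hausdorff semi-metric `dist(A, B) = sup_{a ∈ A} inf_{b ∈ B} d(a, b)`
(equal to `0` if `A` or `B` is empty). -/
noncomputable def hsDist {X : Type*} [MetricSpace X] (A B : Set X) : ℝ :=
  ⨆ a : A, Metric.infDist (a : X) B

/-- The skew-product semiflow `π(t, (p, x)) = (θ_t p, φ(t, p, x))` on `𝕌 = P × X`. -/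
def skew (S : NDS P X) : ℝ → P × X → P × X :=
  fun t u => (S.θ t u.1, S.φ t u.1 u.2)

/-- An `(ε, T)`-chain for a semiflow `π` on a metric space from `u` to `v`. -/
def flowChain {α : Type*} [MetricSpace α] (π : ℝ → α → α) (ε : α → ℝ) (T : ℝ)
    (u v : α) : Prop :=
  ∃ n : ℕ, ∃ us : Fin (n + 2) → α, ∃ ts : Fin (n + 1) → ℝ,
    us 0 = u ∧ us (Fin.last (n + 1)) = v ∧ (∀ i, T ≤ ts i) ∧
    ∀ i : Fin (n + 1),
      dist (π (ts i) (us i.castSucc)) (us i.succ) < ε (π (ts i) (us i.castSucc))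

/-- The chain recurrent set of a semiflow `π`. -/
def flowCR {α : Type*} [MetricSpace α] (π : ℝ → α → α) : Set α :=
  {u | ∀ ε : α → ℝ, Continuous ε → (∀ a, 0 < ε a) → ∀ T : ℝ, 0 < T → flowChain π ε T u u}

/-- `U_x(p)`: the set of all endpoints of `(ε, T)(p)`-chains beginning at `x(p)`. -/
def chainReachable (S : NDS P X) (ε : P → X → ℝ) (T : P → ℝ) (x : P → X) (p : P) : Set X :=
  {y | ∃ ymap : P → X, ymap p = y ∧ S.IsChainFT ε T p x ymap}

open scoped Classical in
/-- Distance from a point to a set, with the convention that the distance to the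
empty set is `1`. -/
noncomputable def distConv {X : Type*} [MetricSpace X] (x : X) (A : Set X) : ℝ :=
  if A = ∅ then 1 else Metric.infDist x A

/-- The function `λ(p, x) = dist(x, A(p)) / (dist(x, A(p)) + dist(x, R(p)))`
(with the empty-set conventions). -/
noncomputable def lamFn (A R : P → Set X) (p : P) (x : X) : ℝ :=
  distConv x (A p) / (distConv x (A p) + distConv x (R p))

/-- The function `g(p, x) = sup_{t ≥ 0} λ(θ_t p, φ(t, p) x)`. -/
noncomputable def gFn (S : NDS P X) (A R : P → Set X) (p : P) (x : X) : ℝ :=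
  ⨆ t : {t : ℝ // 0 ≤ t}, lamFn A R (S.θ (t : ℝ) p) (S.φ (t : ℝ) p x)

/-- The function `l(p, x) = ∫_0^∞ e^{-t} g(θ_t p, φ(t, p) x) dt`. -/
noncomputable def lFn (S : NDS P X) (A R : P → Set X) (p : P) (x : X) : ℝ :=
  ∫ t in Set.Ioi (0 : ℝ), Real.exp (-t) * gFn S A R (S.θ t p) (S.φ t p x)

end NDS

/-- Pointwise moduli of continuity with continuous positive tolerance can be chosen continuous. -/
theorem exists_continuous_pos_modulus {X Y : Type*} [PseudoMetricSpace X] [PseudoMetricSpace Y]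
    {f : X → Y} {g : X → ℝ} (hf : Continuous f) (hg : Continuous g) (hg0 : ∀ u, 0 < g u) :
    ∃ δ : X → ℝ, Continuous δ ∧ (∀ u, 0 < δ u) ∧
      ∀ u v, dist u v < δ u → dist (f u) (f v) < g u := by
  let C : Set (X × X) := {q | g q.1 ≤ dist (f q.1) (f q.2)}
  have hC : IsClosed C := isClosed_le (by fun_prop) (by fun_prop)
  rcases C.eq_empty_or_nonempty with hempty | hne
  · refine ⟨fun _ => 1, continuous_const, fun _ => one_pos, fun u v _ => ?_⟩
    by_contra! h
    exact (hempty ▸ (show (u, v) ∈ C from h) : (u, v) ∈ (∅ : Set (X × X)))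
  · refine ⟨fun u => infDist (u, u) C, by fun_prop, fun u => ?_, fun u v huv => ?_⟩
    · refine (hC.notMem_iff_infDist_pos hne).1 fun h => ?_
      have h' : g u ≤ dist (f u) (f u) := h
      rw [dist_self] at h'
      exact (hg0 u).not_ge h'
    · by_contra! h
      have h' : infDist (u, u) C ≤ dist (u, u) (u, v) :=
        infDist_le_dist_of_mem (show (u, v) ∈ C from h)
      rw [Prod.dist_eq, dist_self, max_eq_right dist_nonneg] at h'
      exact h'.not_gt huv

namespace NDS

variable {P X : Type*} [MetricSpace P] [MetricSpace X]

theorem theta_neg_theta (S : NDS P X) (s : ℝ) (p : P) : S.θ (-s) (S.θ s p) = p := by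
  rw [← S.theta_add, neg_add_cancel, S.theta_zero]

theorem theta_theta_neg (S : NDS P X) (s : ℝ) (p : P) : S.θ s (S.θ (-s) p) = p := by
  rw [← S.theta_add, add_neg_cancel, S.theta_zero]

theorem theta_comm (S : NDS P X) (s t : ℝ) (p : P) : S.θ s (S.θ t p) = S.θ t (S.θ s p) := by
  rw [← S.theta_add, add_comm, S.theta_add]

theorem continuous_phi_apply (S : NDS P X) (t : ℝ) (p : P) : Continuous (S.φ t p) :=
  S.phi_cont.comp (by fun_prop : Continuous fun x : X => (t, p, x))

/-- The image of a map `x : P → X` under the time-`s` pullback of the cocycle. -/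
def pushMap (S : NDS P X) (s : ℝ) (x : P → X) : P → X :=
  fun p => S.φ s (S.θ (-s) p) (x (S.θ (-s) p))

theorem pushMap_theta (S : NDS P X) (s : ℝ) (x : P → X) (p : P) :
    S.pushMap s x (S.θ s p) = S.φ s p (x p) := by
  simp only [pushMap, theta_neg_theta]

theorem pushMap_pushMap_comm (S : NDS P X) {s t : ℝ} (hs : 0 ≤ s) (ht : 0 ≤ t) (x : P → X) :
    S.pushMap t (S.pushMap s x) = S.pushMap s (S.pushMap t x) := by
  funext p
  have key : ∀ {a b : ℝ}, 0 ≤ a → 0 ≤ b → S.pushMap a (S.pushMap b x) p =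
      S.φ (a + b) (S.θ (-b) (S.θ (-a) p)) (x (S.θ (-b) (S.θ (-a) p))) := by
    intro a b ha hb
    rw [S.cocycle _ _ _ _ ha hb, theta_theta_neg]
    rfl
  rw [key ht hs, key hs ht, add_comm, theta_comm]

theorem ChainRecurrentMap.pushMap {S : NDS P X} {x : P → X} (hx : S.ChainRecurrentMap x)
    {s : ℝ} (hs : 0 ≤ s) : S.ChainRecurrentMap (S.pushMap s x) := by
  intro ε hε T hT p
  choose δ hδc hδ0 hδ using fun q => exists_continuous_pos_modulus (S.continuous_phi_apply s q)
    ((hε.1 (S.θ s q)).comp (S.continuous_phi_apply s q)) (fun _ => hε.2 _ _)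
  obtain ⟨n, xs, ts, h0, hl, hts, hchain⟩ :=
    hx δ ⟨hδc, hδ0⟩ (fun q => T (S.θ s q)) (fun _ => hT _) (S.θ (-s) p)
  simp only [theta_theta_neg] at hts
  refine ⟨n, fun i => S.pushMap s (xs i), ts, ?_, ?_, hts, fun i => ?_⟩
  · simp only [NDS.pushMap, h0]
  · simp only [NDS.pushMap, hl]
  · have hcomm := congrFun (S.pushMap_pushMap_comm hs ((hT p).le.trans (hts i)) (xs i.castSucc)) p
    have h := hδ _ _ _ (hchain i)
    simp only [Function.comp_apply, theta_theta_neg] at h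
    change dist (S.pushMap (ts i) (S.pushMap s (xs i.castSucc)) p) _ <
      ε p (S.pushMap (ts i) (S.pushMap s (xs i.castSucc)) p)
    rw [hcomm]
    exact h

theorem ChainRecurrentMap.phi_mem_CR {S : NDS P X} {x : P → X} (hx : S.ChainRecurrentMap x)
    {s : ℝ} (hs : 0 ≤ s) (p : P) : S.φ s p (x p) ∈ S.CR (S.θ s p) :=
  ⟨S.pushMap s x, hx.pushMap hs, S.pushMap_theta s x p⟩

end NDS

/-- Forward invariance of the chain recurrent set: if `x` is chain recurrent and `s ≥ 0`,
then `p ↦ φ(s, θ_{-s} p, x(θ_{-s} p))` is chain recurrent; in particular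
`φ(s, p, x(p)) ∈ CR_φ(θ_s p)` and `φ(s, p, CR_φ(p)) ⊆ CR_φ(θ_s p)`. -/
theorem chainRecurrent_forwardInvariant {P X : Type*} [MetricSpace P] [MetricSpace X]
    (S : NDS P X) (x : P → X) (hx : S.ChainRecurrentMap x) (s : ℝ) (hs : 0 ≤ s) :
    S.ChainRecurrentMap (fun p => S.φ s (S.θ (-s) p) (x (S.θ (-s) p))) ∧
    (∀ p, S.φ s p (x p) ∈ S.CR (S.θ s p)) ∧
    (∀ p, S.φ s p '' S.CR p ⊆ S.CR (S.θ s p)) := by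
  refine ⟨hx.pushMap hs, hx.phi_mem_CR hs, fun p => ?_⟩
  rintro _ ⟨_, ⟨y, hy, rfl⟩, rfl⟩
  exact hy.phi_mem_CR hs p
end

section
/- Let ⟨X, φ, (P, 𝕋, θ)⟩ be a nonautonomous dynamical system and π : 𝕋⁺ × 𝕌 → 𝕌 the associated skew-product semiflow on 𝕌 = P × X. Suppose U ⊂ 𝕌 is an open set which is a pre-attractor for π, i.e., cl(⋃_{s ≥ T} π(s, U)) ⊂ U for some T ≥ 0, and let U(p) = {x ∈ X : (p,x) ∈ U}. Then for each p ∈ P the fiber family (U(p)) is a pre-attractor for φ (with τ ≡ T), A(p) = ⋂_{t ≥ T} cl(⋃_{s ≥ t} φ(s, θ_{-s} p, U(θ_{-s} p))) is the corresponding local attractor, and ⋃_{p∈P} {p} × A(p) ⊂ A, where A = ⋂_{t ≥ T} cl(⋃_{s ≥ t} π(s, U)) is the local attractor for π determined by U (with the convention (p, ∅) = ∅). -/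
open Set Metric Filter Topology TopologicalSpace

namespace NDS

/-- The fibers of `U` transported by the cocycle, placed over `p`, lie in the forward images of `U`
under the skew-product semiflow, also after taking closures. -/
theorem mk_mem_closure_skew_of_mem_omegaSet {P X : Type*} [MetricSpace P] [MetricSpace X]
    (S : NDS P X) (U : Set (P × X)) (t : ℝ) {p : P} {x : X}
    (hx : x ∈ S.omegaSet (fun q => {y : X | (q, y) ∈ U}) t p) :
    (p, x) ∈ closure (⋃ s ∈ Set.Ici t, S.skew s '' U) := by
  refine map_mem_closure (Continuous.prodMk_right p) hx fun y hy => ?_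
  simp only [Set.mem_iUnion] at hy ⊢
  obtain ⟨s, hs, z, hz, rfl⟩ := hy
  refine ⟨s, hs, (S.θ (-s) p, z), hz, ?_⟩
  simp only [skew, ← S.theta_add, add_neg_cancel, S.theta_zero]

end NDS

/-- **Lemma 3.10**: if `U ⊆ P × X` is an (open) pre-attractor for the skew-product
semiflow `π`, then its fibers form a pre-attractor for the cocycle `φ` (with `τ ≡ T`),
`A(p) = ⋂_{t ≥ T} cl(⋃_{s ≥ t} φ(s, θ_{-s} p, U(θ_{-s} p)))` is the corresponding local
attractor, and `⋃_{p} {p} × A(p)` is contained in the local attractor of `π`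
determined by `U`. -/
theorem skew_preAttractor_fiber {P X : Type*} [MetricSpace P] [MetricSpace X]
    (S : NDS P X) (U : Set (P × X)) (hUopen : IsOpen U) (T : ℝ) (hT : 0 ≤ T)
    (hpre : closure (⋃ s ∈ Set.Ici T, S.skew s '' U) ⊆ U) :
    (∀ p : P, IsOpen {x : X | (p, x) ∈ U}) ∧
    (∀ p : P, S.omegaSet (fun q => {x : X | (q, x) ∈ U}) T p ⊆ {x : X | (p, x) ∈ U}) ∧
    (⋃ p : P, (fun x : X => (p, x)) ''
        (⋂ t ∈ Set.Ici T, S.omegaSet (fun q => {x : X | (q, x) ∈ U}) t p))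
      ⊆ ⋂ t ∈ Set.Ici T, closure (⋃ s ∈ Set.Ici t, S.skew s '' U) := by
  refine ⟨fun p => hUopen.preimage (Continuous.prodMk_right p),
    fun p x hx => hpre (S.mk_mem_closure_skew_of_mem_omegaSet U T hx), ?_⟩
  refine Set.iUnion_subset fun p => ?_
  rintro _ ⟨x, hx, rfl⟩
  simp only [Set.mem_iInter] at hx ⊢
  exact fun t ht => S.mk_mem_closure_skew_of_mem_omegaSet U t (hx t ht)
end
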